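/- Let 𝒰 ⊆ ℝ, let f : 𝒰^n → ℝ have M = M_Lip(f) and J = J_Lip(f) finite, and for k ∈ {1,…,n} define F_k : 𝒰^{2n} → ℝ by F_k(x, x′) = 2^{−k} Σ_{A ⊆ [1,k−1]} ( D^k_{x_k, x′_k} f(x^A) + D^k_{x_k, x′_k} f(x^{A^c}) ), where A^c is the complement of A in {1,…,n}. Then for all (x, x′), (y, y′) ∈ 𝒰^{2n} and every k ∈ {1,…,n}, F_k(x, x′) − F_k(y, y′) ≤ √(π/2) · E| ⟨γ, v^k(x, x′) − v^k(y, y′)⟩ |, where γ is a vector of 2n independent standard normal random variables. -/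

import Mathlib

open MeasureTheory ProbabilityTheory

/-- The `k`-th partial difference operator:
`D^k_{y,y'} f(x) = f(…,x_{k-1},y,x_{k+1},…) - f(…,x_{k-1},y',x_{k+1},…)`. -/
def pdiff {α : Type*} {n : ℕ} (f : (Fin n → α) → ℝ) (k : Fin n) (y y' : α)
    (x : Fin n → α) : ℝ :=
  f (Function.update x k y) - f (Function.update x k y')

/-- `x^A`: the vector whose `i`-th coordinate is `x'_i` if `i ∈ A` and `x_i` otherwise. -/
def subst {α : Type*} {n : ℕ} (x x' : Fin n → α) (A : Finset (Fin n)) : Fin n → α :=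
  fun i => if i ∈ A then x' i else x i

/-- `F_k(x,x') = 2^{-k} ∑_{A ⊆ [1,k-1]} (D^k_{x_k,x'_k} f(x^A) + D^k_{x_k,x'_k} f(x^{Aᶜ}))`. -/
noncomputable def Fk {n : ℕ} (f : (Fin n → ℝ) → ℝ) (k : Fin n) (x x' : Fin n → ℝ) : ℝ :=
  (1 / 2 ^ ((k : ℕ) + 1) : ℝ) * ∑ A ∈ (Finset.Iio k).powerset,
    (pdiff f k (x k) (x' k) (subst x x' A) + pdiff f k (x k) (x' k) (subst x x' Aᶜ))

/-- The vector `v^k(x,x') ∈ ℝ^{2n}` (indexed by `Fin n ⊕ Fin n`): its `i`-th component is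
`2M x_k` if `i = k`, `J n^{-1/2} x_i` if `i ≤ n`, `i ≠ k`, `2M x'_k` if `i = n + k` and
`J n^{-1/2} x'_{i-n}` if `i > n`, `i ≠ n + k`. -/
noncomputable def vK {n : ℕ} (M J : ℝ) (k : Fin n) (x x' : Fin n → ℝ) :
    (Fin n ⊕ Fin n) → ℝ :=
  Sum.elim (fun i => if i = k then 2 * M * x k else J / Real.sqrt n * x i)
    (fun i => if i = k then 2 * M * x' k else J / Real.sqrt n * x' i)

theorem aux_abs_gauss : ∫ x : ℝ, |x| ∂(gaussianReal 0 1) = Real.sqrt (2 / Real.pi) := by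
  rw [integral_gaussianReal_eq_integral_smul one_ne_zero]
  have h1 : ∀ x : ℝ, gaussianPDFReal 0 1 x • |x|
      = (fun t : ℝ => (Real.sqrt (2 * Real.pi))⁻¹ * (t ^ (1:ℝ) * Real.exp (-(1/2) * t ^ (2:ℝ)))) |x| := by
    intro x
    have h2 : (|x| : ℝ) ^ (2:ℝ) = x ^ 2 := by
      rw [Real.rpow_two, sq_abs]
    simp only [gaussianPDFReal, h2, Real.rpow_one, smul_eq_mul]
    have h3 : -(x - 0) ^ 2 / (2 * ((1 : NNReal) : ℝ)) = -(1/2) * x ^ 2 := by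
      push_cast; ring
    rw [h3]
    push_cast
    rw [mul_one]; ring
  simp_rw [h1]
  rw [integral_comp_abs (f := fun t : ℝ => (Real.sqrt (2 * Real.pi))⁻¹ * (t ^ (1:ℝ) * Real.exp (-(1/2) * t ^ (2:ℝ)))),
    integral_const_mul,
    integral_rpow_mul_exp_neg_mul_rpow (by norm_num) (by norm_num) (by norm_num)]
  have h4 : ((1:ℝ)/2) ^ (-((1:ℝ) + 1) / 2) = 2 := by
    rw [show (-((1:ℝ) + 1) / 2) = -1 by norm_num, Real.rpow_neg_one]; norm_num
  rw [h4, show ((1:ℝ)+1)/2 = 1 by norm_num, Real.Gamma_one]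
  rw [eq_comm, Real.sqrt_eq_iff_mul_self_eq (by positivity) (by positivity)]
  have hp := Real.pi_pos
  have h5 : Real.sqrt (2 * Real.pi) * Real.sqrt (2 * Real.pi) = 2 * Real.pi :=
    Real.mul_self_sqrt (by positivity)
  have h6 : Real.sqrt (2 * Real.pi) ≠ 0 := by positivity
  field_simp
  nlinarith

theorem aux_gauss {ι : Type*} [Fintype ι] (v : ι → ℝ) :
    Real.sqrt (Real.pi / 2) * ∫ γ : ι → ℝ, |∑ i, γ i * v i|
      ∂(Measure.pi fun _ : ι => gaussianReal 0 1) = Real.sqrt (∑ i, v i ^ 2) := by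
  set w : EuclideanSpace ℝ ι := WithLp.toLp 2 v with hw
  have hnorm : ‖w‖ = Real.sqrt (∑ i, v i ^ 2) := by
    rw [EuclideanSpace.norm_eq]; simp [hw]
  have hL : ‖innerSL ℝ w‖ = ‖w‖ := innerSL_apply_norm ℝ w
  have hmap : (stdGaussian (EuclideanSpace ℝ ι)).map (innerSL ℝ w)
      = (gaussianReal 0 1).map (fun t => ‖w‖ * t) := by
    rw [IsGaussian.map_eq_gaussianReal (innerSL ℝ w), integral_strongDual_stdGaussian,
      variance_dual_stdGaussian, hL, gaussianReal_map_const_mul]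
    congr 1
    · simp
    · ext; simp
  have h1 : ∫ γ : ι → ℝ, |∑ i, γ i * v i| ∂(Measure.pi fun _ : ι => gaussianReal 0 1)
      = ∫ z, |innerSL ℝ w z| ∂(stdGaussian (EuclideanSpace ℝ ι)) := by
    rw [← map_pi_eq_stdGaussian, integral_map (by fun_prop) (by fun_prop)]
    congr 1
  have h2 : ∫ z, |innerSL ℝ w z| ∂(stdGaussian (EuclideanSpace ℝ ι))
      = ∫ t, |t| ∂((stdGaussian (EuclideanSpace ℝ ι)).map (innerSL ℝ w)) := by
    rw [integral_map (by fun_prop) (by fun_prop)]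
  rw [h1, h2, hmap, integral_map (by fun_prop) (by fun_prop)]
  simp_rw [abs_mul, abs_norm]
  rw [integral_const_mul, aux_abs_gauss, hnorm, mul_left_comm, ← Real.sqrt_mul (by positivity)]
  have : Real.pi / 2 * (2 / Real.pi) = 1 := by
    have := Real.pi_pos
    field_simp
  rw [this]; simp

theorem aux_tele {n : ℕ} (U : Set ℝ) (g : (Fin n → ℝ) → ℝ) (c : Fin n → ℝ)
    (hg : ∀ (x : Fin n → ℝ), (∀ i, x i ∈ U) → ∀ (l : Fin n) (z z' : ℝ), z ∈ U → z' ∈ U →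
      pdiff g l z z' x ≤ c l * |z - z'|)
    (w w' : Fin n → ℝ) (hw : ∀ i, w i ∈ U) (hw' : ∀ i, w' i ∈ U) (S : Finset (Fin n)) :
    g (subst w' w S) - g w' ≤ ∑ l ∈ S, c l * |w l - w' l| := by
  induction S using Finset.induction_on with
  | empty =>
    have : subst w' w ∅ = w' := by ext i; simp [subst]
    simp [this]
  | insert a S ha ih =>
    rw [Finset.sum_insert ha]
    have hx : ∀ i, subst w' w S i ∈ U := by
      intro i; unfold subst; split_ifs
      · exact hw i
      · exact hw' i
    have h := hg (subst w' w S) hx a (w a) (w' a) (hw a) (hw' a)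
    have e1 : Function.update (subst w' w S) a (w a) = subst w' w (insert a S) := by
      ext i
      by_cases h : i = a
      · subst h; simp [_root_.subst]
      · simp [_root_.subst, h]
    have e2 : Function.update (subst w' w S) a (w' a) = subst w' w S := by
      ext i
      by_cases h : i = a
      · subst h; simp [_root_.subst, ha]
      · simp [h]
    unfold pdiff at h
    rw [e1, e2] at h
    linarith

theorem aux_term {n : ℕ} (U : Set ℝ) (f : (Fin n → ℝ) → ℝ)
    (M J : ℝ)
    (hM : ∀ (x : Fin n → ℝ), (∀ i, x i ∈ U) →
      ∀ (k : Fin n) (y y' : ℝ), y ∈ U → y' ∈ U →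
      pdiff f k y y' x ≤ M * |y - y'|)
    (hJ : ∀ (k l : Fin n), k ≠ l →
      ∀ (x : Fin n → ℝ), (∀ i, x i ∈ U) →
      ∀ (y y' z z' : ℝ), y ∈ U → y' ∈ U → z ∈ U → z' ∈ U →
      pdiff (fun w => pdiff f k y y' w) l z z' x ≤ (J / n) * |y - y'|)
    (k : Fin n) (a a' b b' : ℝ) (ha : a ∈ U) (ha' : a' ∈ U) (hb : b ∈ U) (hb' : b' ∈ U)
    (w w' : Fin n → ℝ) (hw : ∀ i, w i ∈ U) (hw' : ∀ i, w' i ∈ U) :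
    pdiff f k a a' w - pdiff f k b b' w' ≤ M * |a - b| + M * |a' - b'|
      + ∑ l, (if l = k then 0 else J / n) * |w l - w' l| := by
  have h1 := hM w hw k a b ha hb
  have h2 := hM w hw k b' a' hb' ha'
  have h3 := aux_tele U (fun w => pdiff f k b b' w) (fun l => if l = k then 0 else J / n)
    (by
      intro x hx l z z' hz hz'
      split_ifs with h
      · subst h; simp [pdiff]
      · have := hJ l k h x hx z z' b b' hz hz' hb hb'
        refine le_trans (le_of_eq ?_) this
        simp only [pdiff]
        simp only [Function.update_comm h]
        ring) w w' hw hw' Finset.univ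
  have e : subst w' w Finset.univ = w := by ext i; simp [subst]
  rw [e] at h3
  rw [abs_sub_comm b' a'] at h2
  simp only [pdiff] at *
  linarith

theorem aux_F {n : ℕ} (U : Set ℝ) (f : (Fin n → ℝ) → ℝ)
    (M J : ℝ)
    (hM : ∀ (x : Fin n → ℝ), (∀ i, x i ∈ U) →
      ∀ (k : Fin n) (y y' : ℝ), y ∈ U → y' ∈ U →
      pdiff f k y y' x ≤ M * |y - y'|)
    (hJ : ∀ (k l : Fin n), k ≠ l →
      ∀ (x : Fin n → ℝ), (∀ i, x i ∈ U) →
      ∀ (y y' z z' : ℝ), y ∈ U → y' ∈ U → z ∈ U → z' ∈ U →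
      pdiff (fun w => pdiff f k y y' w) l z z' x ≤ (J / n) * |y - y'|)
    (x x' y y' : Fin n → ℝ) (hx : ∀ i, x i ∈ U) (hx' : ∀ i, x' i ∈ U)
    (hy : ∀ i, y i ∈ U) (hy' : ∀ i, y' i ∈ U) (k : Fin n) :
    Fk f k x x' - Fk f k y y' ≤ M * |x k - y k| + M * |x' k - y' k|
      + (1 / 2) * ∑ l, (if l = k then 0 else J / n) * (|x l - y l| + |x' l - y' l|) := by
  have hs : ∀ (p q : Fin n → ℝ), (∀ i, p i ∈ U) → (∀ i, q i ∈ U) → ∀ A i, subst p q A i ∈ U := by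
    intro p q hp hq A i; unfold subst; split_ifs
    · exact hq i
    · exact hp i
  set B := M * |x k - y k| + M * |x' k - y' k|
      + (1 / 2) * ∑ l, (if l = k then 0 else J / n) * (|x l - y l| + |x' l - y' l|) with hB
  have key : ∀ A ∈ (Finset.Iio k).powerset,
      (pdiff f k (x k) (x' k) (subst x x' A) + pdiff f k (x k) (x' k) (subst x x' Aᶜ))
      - (pdiff f k (y k) (y' k) (subst y y' A) + pdiff f k (y k) (y' k) (subst y y' Aᶜ))
      ≤ 2 * B := by
    intro A _
    have h1 := aux_term U f M J hM hJ k (x k) (x' k) (y k) (y' k) (hx k) (hx' k) (hy k) (hy' k)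
      (subst x x' A) (subst y y' A) (hs _ _ hx hx' _) (hs _ _ hy hy' _)
    have h2 := aux_term U f M J hM hJ k (x k) (x' k) (y k) (y' k) (hx k) (hx' k) (hy k) (hy' k)
      (subst x x' Aᶜ) (subst y y' Aᶜ) (hs _ _ hx hx' _) (hs _ _ hy hy' _)
    have h3 : ∑ l, (if l = k then 0 else J / n) * |subst x x' A l - subst y y' A l|
        + ∑ l, (if l = k then 0 else J / n) * |subst x x' Aᶜ l - subst y y' Aᶜ l|
        = ∑ l, (if l = k then 0 else J / n) * (|x l - y l| + |x' l - y' l|) := by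
      rw [← Finset.sum_add_distrib]
      refine Finset.sum_congr rfl fun l _ => ?_
      rw [← mul_add]
      congr 1
      by_cases h : l ∈ A
      · simp [subst, h, add_comm]
      · simp [subst, h]
    linarith
  have hsum := Finset.sum_le_sum key
  rw [Finset.sum_sub_distrib, Finset.sum_const, Finset.card_powerset, Fin.card_Iio,
    nsmul_eq_mul] at hsum
  unfold Fk
  rw [← mul_sub]
  refine (mul_le_mul_of_nonneg_left hsum (by positivity)).trans (le_of_eq ?_)
  push_cast
  rw [pow_succ]
  field_simp

/-- Lemma 5 of the paper: with `M = M_Lip(f)` and `J = J_Lip(f)`,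
`F_k(x,x') - F_k(y,y') ≤ √(π/2)·E|⟨γ, v^k(x,x') - v^k(y,y')⟩|`
for a standard Gaussian vector `γ` in `ℝ^{2n}`. -/
theorem Fk_difference_bound {n : ℕ} (U : Set ℝ) (f : (Fin n → ℝ) → ℝ)
    (M J : ℝ) (hM0 : 0 ≤ M) (hJ0 : 0 ≤ J)
    (hM : ∀ (x : Fin n → ℝ), (∀ i, x i ∈ U) →
      ∀ (k : Fin n) (y y' : ℝ), y ∈ U → y' ∈ U →
      pdiff f k y y' x ≤ M * |y - y'|)
    (hJ : ∀ (k l : Fin n), k ≠ l →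
      ∀ (x : Fin n → ℝ), (∀ i, x i ∈ U) →
      ∀ (y y' z z' : ℝ), y ∈ U → y' ∈ U → z ∈ U → z' ∈ U →
      pdiff (fun w => pdiff f k y y' w) l z z' x ≤ (J / n) * |y - y'|) :
    ∀ (x x' y y' : Fin n → ℝ), (∀ i, x i ∈ U) → (∀ i, x' i ∈ U) →
      (∀ i, y i ∈ U) → (∀ i, y' i ∈ U) → ∀ k : Fin n,
      Fk f k x x' - Fk f k y y' ≤ Real.sqrt (Real.pi / 2) *
        ∫ γ : (Fin n ⊕ Fin n) → ℝ,
          |∑ i : Fin n ⊕ Fin n, γ i * (vK M J k x x' i - vK M J k y y' i)|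
          ∂(Measure.pi fun _ : Fin n ⊕ Fin n => gaussianReal 0 1) := by
  intro x x' y y' hx hx' hy hy' k
  rw [aux_gauss]
  refine (aux_F U f M J hM hJ x x' y y' hx hx' hy hy' k).trans ?_
  have hn : 0 < (n : ℝ) := by exact_mod_cast k.pos
  have hsn : 0 < Real.sqrt n := Real.sqrt_pos.mpr hn
  have hss : Real.sqrt n * Real.sqrt n = n := Real.mul_self_sqrt hn.le
  let d : Fin n → ℝ := fun i => if i = k then 1 / 2 else 1 / (2 * Real.sqrt n)
  let c : Fin n ⊕ Fin n → ℝ := Sum.elim d d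
  let v : Fin n ⊕ Fin n → ℝ := fun i => vK M J k x x' i - vK M J k y y' i
  have hd : ∑ i, d i ^ 2 ≤ 1 / 2 := by
    have h1 : ∀ i, d i ^ 2 ≤ (if i = k then 1 / 4 else 0) + 1 / (4 * n) - 
        (if i = k then 1 / (4 * (n : ℝ)) else 0) := by
      intro i
      simp only [d]
      split_ifs
      · norm_num
      · rw [div_pow, mul_pow, Real.sq_sqrt hn.le]; norm_num
    refine (Finset.sum_le_sum fun i _ => h1 i).trans ?_
    rw [Finset.sum_sub_distrib, Finset.sum_add_distrib]
    simp only [Finset.sum_ite_eq', Finset.mem_univ, if_true, Finset.sum_const, Finset.card_univ,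
      Fintype.card_fin, nsmul_eq_mul]
    have : (n : ℝ) * (1 / (4 * n)) = 1 / 4 := by field_simp
    rw [this]
    have : 0 < 1 / (4 * (n : ℝ)) := by positivity
    linarith
  have hc : ∑ i, c i ^ 2 ≤ 1 := by
    rw [Fintype.sum_sum_type]
    simp only [c, Sum.elim_inl, Sum.elim_inr]
    linarith
  have hv : ∑ i, |v i| ^ 2 = ∑ i, v i ^ 2 := by simp only [sq_abs]
  have hcs := Finset.sum_mul_sq_le_sq_mul_sq Finset.univ c (fun i => |v i|)
  rw [hv] at hcs
  have hvn : 0 ≤ ∑ i, v i ^ 2 := Finset.sum_nonneg fun i _ => sq_nonneg _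
  have hle : ∑ i, c i * |v i| ≤ Real.sqrt (∑ i, v i ^ 2) := by
    apply Real.le_sqrt_of_sq_le
    nlinarith
  refine le_trans (le_of_eq ?_) hle
  have hhalf : ∀ (p q : Fin n → ℝ), ∀ i, d i * |(if i = k then 2 * M * p k else J / Real.sqrt n * p i)
      - (if i = k then 2 * M * q k else J / Real.sqrt n * q i)|
      = (if i = k then M * |p k - q k| else 0)
        + (1 / 2) * ((if i = k then 0 else J / n) * |p i - q i|) := by
    intro p q i
    simp only [d]
    split_ifs with h
    · rw [← mul_sub, abs_mul, abs_of_nonneg (by positivity : 0 ≤ 2 * M)]; ring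
    · rw [← mul_sub, abs_mul, abs_of_nonneg (by positivity : 0 ≤ J / Real.sqrt n)]
      have e : J / (n : ℝ) = J / (Real.sqrt n * Real.sqrt n) := by rw [hss]
      rw [e]; field_simp; try ring
  rw [Fintype.sum_sum_type]
  simp only [c, v, vK, Sum.elim_inl, Sum.elim_inr, hhalf]
  simp only [Finset.sum_add_distrib, Finset.sum_ite_eq', Finset.mem_univ, if_true, mul_add,
    ← Finset.mul_sum]
  ring
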